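/- Let p be an odd prime and suppose x, y, z are nonzero pairwise coprime integers with x^p + y^p = z^p and p ∣ z. Then p² ∣ z and p^(2p−1) ∣ (x + y). -/

import Mathlib

/-- If `p` is odd, `a` and `b` are coprime, and `a ^ p - b ^ p` is the `p`-th power of an integer
coprime to `p`, then `a - b` is itself a `p`-th power. -/
theorem Int.exists_sub_eq_pow_of_pow_sub_pow_eq_pow {p : ℕ} (hodd : Odd p) {a b c : ℤ}
    (hab : IsCoprime a b) (hpc : IsCoprime (p : ℤ) c) (h : a ^ p - b ^ p = c ^ p) :
    ∃ d : ℤ, a - b = d ^ p := by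
  have hmul : (a - b) * ∑ i ∈ Finset.range p, a ^ i * b ^ (p - 1 - i) = c ^ p := by
    rw [mul_comm, Commute.geom_sum₂_mul (Commute.all a b), h]
  have hp : IsCoprime (a - b) (p : ℤ) :=
    ((hpc.pow_right (n := p)).of_isCoprime_of_dvd_right ⟨_, hmul.symm⟩).symm
  have hb : IsCoprime (a - b) b := by
    simpa [sub_eq_add_neg] using hab.add_mul_left_left (-1)
  have hcop : IsCoprime (a - b) (∑ i ∈ Finset.range p, a ^ i * b ^ (p - 1 - i)) := by
    have hdvd : a - b ∣ (∑ i ∈ Finset.range p, a ^ i * b ^ (p - 1 - i)) - p * b ^ (p - 1) := by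
      have heq : Ideal.Quotient.mk (Ideal.span {a - b}) a = Ideal.Quotient.mk _ b :=
        Ideal.Quotient.eq.mpr (Ideal.mem_span_singleton_self _)
      rw [← Ideal.mem_span_singleton, ← Ideal.Quotient.eq]
      simp only [RingHom.map_geom_sum₂, heq, geom_sum₂_self, map_mul, map_pow, map_natCast]
    obtain ⟨k, hk⟩ := hdvd
    rw [eq_add_of_sub_eq hk, add_comm]
    exact (hp.mul_right hb.pow_right).add_mul_left_right k
  exact Int.eq_pow_of_mul_eq_pow_odd_left hcop hodd hmul

/-- Second-case Fermat divisibility relations: if `p` is an odd prime and `x, y, z` are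
nonzero pairwise coprime integers with `x^p + y^p = z^p` and `p ∣ z`, then `p² ∣ z` and
`p^(2p-1) ∣ (x + y)`. -/
theorem flt2_divisibility {p : ℕ} (hp : p.Prime) (hodd : Odd p)
    (x y z : ℤ) (hx : x ≠ 0) (hy : y ≠ 0) (hz : z ≠ 0)
    (hxy : IsCoprime x y) (hyz : IsCoprime y z) (hxz : IsCoprime x z)
    (h : x ^ p + y ^ p = z ^ p) (hpz : (p : ℤ) ∣ z) :
    (p : ℤ) ^ 2 ∣ z ∧ (p : ℤ) ^ (2 * p - 1) ∣ (x + y) := by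
  have hp3 : 3 ≤ p := by
    have := hp.two_le
    obtain ⟨k, rfl⟩ := hodd
    omega
  have hpI : Prime (p : ℤ) := Nat.prime_iff_prime_int.mp hp
  have := Fact.mk hp
  have hdvd_of_pow (a b : ℤ) (hab : (p : ℤ) ∣ a ^ p + b ^ p) : (p : ℤ) ∣ a + b := by
    rw [← ZMod.intCast_zmod_eq_zero_iff_dvd] at hab ⊢
    simpa [ZMod.pow_card] using hab
  have hpx : IsCoprime (p : ℤ) x := (hxz.of_isCoprime_of_dvd_right hpz).symm
  have hpy : IsCoprime (p : ℤ) y := (hyz.of_isCoprime_of_dvd_right hpz).symm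
  have hpxy : (p : ℤ) ∣ x + y :=
    hdvd_of_pow x y (h ▸ dvd_pow hpz hp.ne_zero)
  have hmult (a b : ℤ) (hab : (p : ℤ) ∣ a + b) (ha : ¬ (p : ℤ) ∣ a) :
      emultiplicity (p : ℤ) (a ^ p + b ^ p) = emultiplicity (p : ℤ) (a + b) + 1 := by
    rw [Int.emultiplicity_pow_add_pow hp hodd hab ha hodd]
    congr 1
    exact (Nat.finiteMultiplicity_iff.mpr ⟨hp.ne_one, hp.pos⟩).emultiplicity_self
  have hpow (n : ℕ) (hn : (p : ℤ) ^ n ∣ z) : (p : ℤ) ^ (n * p - 1) ∣ x + y := by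
    have h1 : (p : ℤ) ^ (n * p) ∣ x ^ p + y ^ p := by
      rw [h, pow_mul]
      exact pow_dvd_pow_of_dvd hn p
    rw [pow_dvd_iff_le_emultiplicity,
      hmult x y hpxy fun hd => hpI.not_isUnit (hpx.isUnit_of_dvd' dvd_rfl hd)] at h1
    rw [pow_dvd_iff_le_emultiplicity]
    rcases Nat.eq_zero_or_pos (n * p) with h0 | h0
    · simp [h0]
    · rw [← Nat.sub_add_cancel h0] at h1
      push_cast at h1
      exact (ENat.add_le_add_iff_right ENat.one_ne_top).mp h1
  have hz2 : (p : ℤ) ^ 2 ∣ z := by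
    obtain ⟨b, hb⟩ := Int.exists_sub_eq_pow_of_pow_sub_pow_eq_pow hodd hxz.symm hpy
      (by linarith)
    obtain ⟨c, hc⟩ := Int.exists_sub_eq_pow_of_pow_sub_pow_eq_pow hodd hyz.symm hpx
      (by linarith)
    have hsum : b ^ p + c ^ p = 2 * z - (x + y) := by rw [← hb, ← hc]; ring
    have hpb : ¬ (p : ℤ) ∣ b := fun hd => by
      have h1 : (p : ℤ) ∣ z - x := hb ▸ dvd_pow hd hp.ne_zero
      have h2 : (p : ℤ) ∣ x := (dvd_sub_right hpz).mp h1
      exact hpI.not_isUnit (hpx.isUnit_of_dvd' dvd_rfl h2)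
    have hbc : (p : ℤ) ∣ b + c :=
      hdvd_of_pow b c (hsum ▸ dvd_sub (hpz.mul_left 2) hpxy)
    have h2 : (p : ℤ) ^ 2 ∣ b ^ p + c ^ p := by
      rw [pow_dvd_iff_le_emultiplicity, hmult b c hbc hpb]
      have : ((1 : ℕ) : ℕ∞) ≤ emultiplicity (p : ℤ) (b + c) :=
        le_emultiplicity_of_pow_dvd (by simpa using hbc)
      calc ((2 : ℕ) : ℕ∞) = ((1 : ℕ) : ℕ∞) + 1 := by norm_num
        _ ≤ _ := by gcongr
    have h3 : (p : ℤ) ^ 2 ∣ x + y :=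
      (pow_dvd_pow _ (by omega)).trans (hpow 1 (by simpa using hpz))
    have h4 : (p : ℤ) ^ 2 ∣ 2 * z := by
      rw [hsum] at h2
      simpa using dvd_add h2 h3
    have h5 : IsCoprime ((p : ℤ) ^ 2) 2 :=
      IsCoprime.pow_left (by exact_mod_cast (Nat.coprime_two_right.mpr hodd).isCoprime)
    exact h5.dvd_of_dvd_mul_left h4
  exact ⟨hz2, hpow 2 hz2⟩
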